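/- Let K = ⟨x, y | x⁻¹yx = y⁻¹⟩ be the fundamental group of the Klein bottle. Then the outer automorphism group of K is isomorphic to ℤ/2ℤ × ℤ/2ℤ: the quotient of Aut(K) by the normal subgroup Inn(K) of inner automorphisms is isomorphic as a group to (ℤ/2ℤ) × (ℤ/2ℤ). -/

import Mathlib

/-- The single relator `x⁻¹yxy` of the Klein bottle group `⟨x, y ∣ x⁻¹yx = y⁻¹⟩`,
where `x = FreeGroup.of true` and `y = FreeGroup.of false`. -/
def kleinRels : Set (FreeGroup Bool) :=
  {(FreeGroup.of true)⁻¹ * FreeGroup.of false * FreeGroup.of true * FreeGroup.of false}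

/-- The fundamental group `K = ⟨x, y ∣ x⁻¹yx = y⁻¹⟩` of the Klein bottle. -/
abbrev KleinGroup := PresentedGroup kleinRels

/-- The subgroup `Inn(G) ≤ Aut(G)` of inner automorphisms is normal. -/
instance innNormal (G : Type*) [Group G] :
    ((MulAut.conj : G →* MulAut G).range).Normal := by
  constructor
  intro n hn φ
  obtain ⟨g, rfl⟩ := hn
  refine ⟨φ g, ?_⟩
  ext h
  simp [MulAut.conj, mul_assoc]

namespace KleinGroup

open Multiplicative

/-- The generator `x`. -/
def x : KleinGroup := PresentedGroup.of true

/-- The generator `y`. -/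
def y : KleinGroup := PresentedGroup.of false

theorem relator_eq_one : x⁻¹ * y * x * y = 1 :=
  PresentedGroup.one_of_mem (rels := kleinRels) rfl

theorem y_mul_x : y * x = x * y⁻¹ := by
  rw [← eq_inv_of_mul_eq_one_left relator_eq_one]
  simp [mul_assoc]

theorem x_mul_y : x * y = y⁻¹ * x := by
  rw [eq_inv_mul_iff_mul_eq, ← mul_assoc, y_mul_x, inv_mul_cancel_right]

theorem y_zpow_mul_x (b : ℤ) : y ^ b * x = x * y ^ (-b) := by
  have h : SemiconjBy x y⁻¹ y := y_mul_x.symm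
  simpa using (h.zpow_right b).eq.symm

section lift

variable {G : Type*} [Group G]

/-- The homomorphism out of the Klein bottle group sending `x` to `a` and `y` to `b`. -/
def lift (a b : G) (h : a⁻¹ * b * a * b = 1) : KleinGroup →* G :=
  PresentedGroup.toGroup (f := fun i : Bool => if i then a else b) (by
    rintro r rfl
    simpa using h)

@[simp]
theorem lift_x (a b : G) (h : a⁻¹ * b * a * b = 1) : lift a b h x = a :=
  PresentedGroup.toGroup.of _

@[simp]
theorem lift_y (a b : G) (h : a⁻¹ * b * a * b = 1) : lift a b h y = b :=
  PresentedGroup.toGroup.of _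

theorem hom_ext {f g : KleinGroup →* G} (hx : f x = g x) (hy : f y = g y) : f = g := by
  ext i
  cases i
  exacts [hy, hx]

end lift

/-- The exponent sum of `x`. -/
def xDegree : KleinGroup →* Multiplicative ℤ :=
  lift (ofAdd 1) 1 (by simp)

/-- The exponent sum of `y` modulo `2`. -/
def yParity : KleinGroup →* Multiplicative (ZMod 2) :=
  lift 1 (ofAdd 1) (by decide)

@[simp]
theorem xDegree_x : xDegree x = ofAdd 1 := lift_x _ _ _

@[simp]
theorem xDegree_y : xDegree y = 1 := lift_y _ _ _

@[simp]
theorem yParity_x : yParity x = 1 := lift_x _ _ _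

@[simp]
theorem yParity_y : yParity y = ofAdd 1 := lift_y _ _ _

theorem y_zpow_injective : Function.Injective (fun n : ℤ => y ^ n) := by
  intro m n h
  let f : KleinGroup →* DihedralGroup 0 :=
    lift (.sr 0) (.r 1) (by
      rw [DihedralGroup.inv_sr, DihedralGroup.sr_mul_r, DihedralGroup.sr_mul_sr,
        DihedralGroup.r_mul_r, DihedralGroup.one_def]
      simp)
  have hf := congrArg f h
  simp only [map_zpow, f, lift_y, DihedralGroup.r_one_zpow, DihedralGroup.r.injEq] at hf
  exact Int.cast_injective (α := ℤ) hf

theorem exists_eq_x_zpow_mul_y_zpow (g : KleinGroup) : ∃ a b : ℤ, g = x ^ a * y ^ b := by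
  have hg : g ∈ Subgroup.closure (Set.range (PresentedGroup.of : Bool → KleinGroup)) :=
    PresentedGroup.closure_range_of kleinRels ▸ Subgroup.mem_top g
  induction hg using Subgroup.closure_induction_right with
  | one => exact ⟨0, 0, by simp⟩
  | mul_right g _ z hz ih =>
    obtain ⟨a, b, rfl⟩ := ih
    obtain ⟨_ | _, rfl⟩ := hz
    · exact ⟨a, b + 1, by rw [zpow_add_one, ← mul_assoc]; rfl⟩
    · refine ⟨a + 1, -b, ?_⟩
      rw [zpow_add_one, mul_assoc, mul_assoc, ← y_zpow_mul_x]
      rfl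
  | mul_inv_cancel g _ z hz ih =>
    obtain ⟨a, b, rfl⟩ := ih
    obtain ⟨_ | _, rfl⟩ := hz
    · exact ⟨a, b - 1, by rw [zpow_sub_one, ← mul_assoc]; rfl⟩
    · refine ⟨a - 1, -b, ?_⟩
      change x ^ a * y ^ b * x⁻¹ = _
      rw [mul_inv_eq_iff_eq_mul, mul_assoc, y_zpow_mul_x, zpow_sub_one]
      simp [mul_assoc]

theorem exists_eq_of_xDegree_eq {g : KleinGroup} {a : ℤ} (h : xDegree g = ofAdd a) :
    ∃ b : ℤ, g = x ^ a * y ^ b := by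
  obtain ⟨c, b, rfl⟩ := exists_eq_x_zpow_mul_y_zpow g
  have hc : c = a := by simpa [← ofAdd_zsmul] using h
  exact ⟨b, by rw [hc]⟩

theorem xDegree_apply_y (φ : MulAut KleinGroup) : xDegree (φ y) = 1 := by
  have h := congrArg toAdd (congrArg (fun g => xDegree (φ g)) relator_eq_one)
  simp only [map_mul, map_inv, map_one, toAdd_mul, toAdd_inv, toAdd_one] at h
  apply toAdd.injective
  rw [toAdd_one]
  lia

theorem exists_apply_y_eq_zpow (φ : MulAut KleinGroup) : ∃ b : ℤ, φ y = y ^ b := by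
  simpa using exists_eq_of_xDegree_eq (a := 0) (xDegree_apply_y φ)

theorem apply_y_eq_or_eq_inv (φ : MulAut KleinGroup) : φ y = y ∨ φ y = y⁻¹ := by
  obtain ⟨m, hm⟩ := exists_apply_y_eq_zpow φ
  obtain ⟨n, hn⟩ := exists_apply_y_eq_zpow φ⁻¹
  have h : y ^ (n * m) = y ^ (1 : ℤ) := by
    rw [zpow_mul, ← hn, ← map_zpow, ← hm, MulAut.inv_apply_self, zpow_one]
  rcases Int.eq_one_or_neg_one_of_mul_eq_one' (y_zpow_injective h) with ⟨-, rfl⟩ | ⟨-, rfl⟩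
  · exact .inl (by simpa using hm)
  · exact .inr (by simpa using hm)

theorem yParity_apply_y (φ : MulAut KleinGroup) : yParity (φ y) = ofAdd 1 := by
  rcases apply_y_eq_or_eq_inv φ with h | h <;> rw [h]
  · exact yParity_y
  · rw [map_inv, yParity_y]
    decide

theorem xDegree_apply (φ : MulAut KleinGroup) (g : KleinGroup) :
    xDegree (φ g) = xDegree (φ x) ^ toAdd (xDegree g) := by
  have h : xDegree.comp φ.toMonoidHom = (zpowersHom _ (xDegree (φ x))).comp xDegree :=
    hom_ext (by simp) (by simp [xDegree_apply_y])
  simpa using DFunLike.congr_fun h g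

theorem yParity_apply (φ : MulAut KleinGroup) (g : KleinGroup) :
    yParity (φ g) = yParity (φ x) ^ toAdd (xDegree g) * yParity g := by
  have h : yParity.comp φ.toMonoidHom = (zpowersHom _ (yParity (φ x))).comp xDegree * yParity :=
    hom_ext (by simp) (by simp [yParity_apply_y])
  simpa using DFunLike.congr_fun h g

/-- The sign `ε` of an automorphism `x ↦ x ^ ε * y ^ b`. -/
def autSign : MulAut KleinGroup →* ℤˣ :=
  MonoidHom.toHomUnits
    { toFun φ := toAdd (xDegree (φ x))
      map_one' := by simp
      map_mul' φ ψ := by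
        rw [MulAut.mul_apply, xDegree_apply, toAdd_zpow, smul_eq_mul, mul_comm] }

theorem coe_autSign (φ : MulAut KleinGroup) : (autSign φ : ℤ) = toAdd (xDegree (φ x)) := rfl

/-- The parity of `b` for an automorphism `x ↦ x ^ ε * y ^ b`. -/
def autParity : MulAut KleinGroup →* Multiplicative (ZMod 2) where
  toFun φ := yParity (φ x)
  map_one' := by simp
  map_mul' φ ψ := by
    have hinv : ∀ a : Multiplicative (ZMod 2), a⁻¹ = a := by decide
    rw [MulAut.mul_apply, yParity_apply, ← coe_autSign]
    rcases Int.units_eq_one_or (autSign ψ) with h | h <;> simp [h, hinv]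

theorem autParity_apply (φ : MulAut KleinGroup) : autParity φ = yParity (φ x) := rfl

/-- The automorphism `x ↦ x⁻¹, y ↦ y`. -/
def invX : MulAut KleinGroup :=
  let f : KleinGroup →* KleinGroup := lift x⁻¹ y (by
    rw [inv_inv, x_mul_y, mul_inv_cancel_right, inv_mul_cancel])
  have hf : f.comp f = MonoidHom.id _ := hom_ext (by simp [f]) (by simp [f])
  MonoidHom.toMulEquiv f f hf hf

/-- The automorphism `x ↦ x * y, y ↦ y`. -/
def mulY : MulAut KleinGroup :=
  MonoidHom.toMulEquiv
    (lift (x * y) y (by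
      simpa [mul_assoc] using congrArg (y⁻¹ * · * y) relator_eq_one))
    (lift (x * y⁻¹) y (by
      simpa [mul_assoc] using congrArg (y * · * y⁻¹) relator_eq_one))
    (hom_ext (by simp) (by simp)) (hom_ext (by simp) (by simp))

theorem invX_x : invX x = x⁻¹ := by simp [invX]

theorem mulY_x : mulY x = x * y := by simp [mulY]

/-- The sign and the parity of an automorphism together. -/
def autInvariant : MulAut KleinGroup →* ℤˣ × Multiplicative (ZMod 2) :=
  autSign.prod autParity

theorem autInvariant_invX : autInvariant invX = (-1, 1) := by
  refine Prod.ext (Units.ext ?_) ?_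
  · simp [autInvariant, coe_autSign, invX_x]
  · simp [autInvariant, autParity_apply, invX_x]

theorem autInvariant_mulY : autInvariant mulY = (1, ofAdd 1) := by
  refine Prod.ext (Units.ext ?_) ?_
  · simp [autInvariant, coe_autSign, mulY_x]
  · simp [autInvariant, autParity_apply, mulY_x]

theorem autInvariant_surjective : Function.Surjective autInvariant := by
  have h : ∀ p : ℤˣ × Multiplicative (ZMod 2), ∃ i j : Fin 2,
      (-1, 1) ^ (i : ℕ) * (1, ofAdd 1) ^ (j : ℕ) = p := by
    decide
  intro p
  obtain ⟨i, j, rfl⟩ := h p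
  exact ⟨invX ^ (i : ℕ) * mulY ^ (j : ℕ), by
    rw [map_mul, map_pow, map_pow, autInvariant_invX, autInvariant_mulY]⟩

theorem conj_y_zpow_x (k : ℤ) : MulAut.conj (y ^ k) x = x * y ^ (-(2 * k)) := by
  rw [MulAut.conj_apply, y_zpow_mul_x, mul_assoc, ← zpow_neg, ← zpow_add]
  ring_nf

theorem range_conj_eq_ker_autInvariant :
    (MulAut.conj : KleinGroup →* MulAut KleinGroup).range = autInvariant.ker := by
  apply le_antisymm
  · rintro _ ⟨g, rfl⟩
    refine Prod.ext (Units.ext ?_) ?_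
    · simp [autInvariant, coe_autSign]
    · simp [autInvariant, autParity_apply]
  · intro φ hφ
    have hsign : xDegree (φ x) = ofAdd 1 :=
      congrArg (fun p => ofAdd (p.1 : ℤ)) (MonoidHom.mem_ker.1 hφ)
    have hparity : yParity (φ x) = 1 := congrArg Prod.snd (MonoidHom.mem_ker.1 hφ)
    obtain ⟨b, hb⟩ := exists_eq_of_xDegree_eq hsign
    rw [zpow_one] at hb
    have hb2 : (2 : ℤ) ∣ b := by
      rw [hb, map_mul, map_zpow, yParity_x, yParity_y, one_mul, ← ofAdd_zsmul, ofAdd_eq_one,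
        zsmul_one] at hparity
      exact (ZMod.intCast_zmod_eq_zero_iff_dvd b 2).1 hparity
    obtain ⟨k, rfl⟩ := hb2
    rcases apply_y_eq_or_eq_inv φ with hy | hy
    · refine ⟨y ^ (-k), MulEquiv.toMonoidHom_injective (hom_ext ?_ ?_)⟩
      · simpa [hb] using conj_y_zpow_x (-k)
      · change MulAut.conj (y ^ (-k)) y = φ y
        rw [MulAut.conj_apply, hy]
        group
    · refine ⟨y ^ (-k) * x, MulEquiv.toMonoidHom_injective (hom_ext ?_ ?_)⟩
      · simpa [hb] using conj_y_zpow_x (-k)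
      · change MulAut.conj (y ^ (-k) * x) y = φ y
        rw [MulAut.conj_apply, hy, mul_assoc (y ^ (-k)), x_mul_y]
        group

end KleinGroup

/-- Proposition 7.1: the outer automorphism group `Out(K) = Aut(K)/Inn(K)` of the Klein
bottle group is isomorphic to `ℤ/2ℤ × ℤ/2ℤ`. -/
theorem klein_out_eq_klein_four :
    Nonempty
      ((MulAut KleinGroup ⧸ (MulAut.conj : KleinGroup →* MulAut KleinGroup).range) ≃*
        Multiplicative (ZMod 2) × Multiplicative (ZMod 2)) := by
  let e : ℤˣ ≃* Multiplicative (ZMod 2) :=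
    mulEquivOfPrimeCardEq (p := 2) (by simp) (by simp)
  exact ⟨(QuotientGroup.quotientMulEquivOfEq KleinGroup.range_conj_eq_ker_autInvariant).trans <|
    (QuotientGroup.quotientKerEquivOfSurjective _ KleinGroup.autInvariant_surjective).trans <|
      e.prodCongr (MulEquiv.refl _)⟩
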